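/- arXiv:2204.08666 — 6 statements merged into one kernel-verified Lean document; each statement's English description precedes it below -/
import Mathlib

section
/- Let A be a weighted adjacency matrix on n ≥ 1 vertices whose support graph is connected, and let Q = D + A be its signless Laplacian. Then there exists a nonzero vector x ∈ ℝⁿ with Qx = 0 (i.e. Q is singular) if and only if the support graph of A is bipartite. -/
open Matrix

section SignlessLaplacian

variable {V : Type*} [Fintype V] [DecidableEq V] {A : Matrix V V ℝ}

lemma signlessLaplacian_mulVec_apply (A : Matrix V V ℝ) (x : V → ℝ) (i : V) :
    ((Matrix.diagonal (fun i => ∑ j, A i j) + A) *ᵥ x) i = ∑ j, A i j * (x i + x j) := by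
  rw [Matrix.add_mulVec, Pi.add_apply, Matrix.mulVec_diagonal, Finset.sum_mul]
  simp only [Matrix.mulVec, dotProduct, mul_add, Finset.sum_add_distrib]

/-- The quadratic form of the signless Laplacian is a weighted sum of squares over the edges. -/
lemma sum_mul_add_sq_eq_signlessLaplacian (hsymm : A.IsSymm) (x : V → ℝ) :
    ∑ i, ∑ j, A i j * (x i + x j) ^ 2 =
      2 * (x ⬝ᵥ ((Matrix.diagonal (fun i => ∑ j, A i j) + A) *ᵥ x)) := by
  have hswap : ∑ i, ∑ j, A i j * (x i + x j) * x j = ∑ i, ∑ j, A i j * (x i + x j) * x i := by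
    rw [Finset.sum_comm]
    refine Finset.sum_congr rfl fun i _ => Finset.sum_congr rfl fun j _ => ?_
    rw [hsymm.apply i j, add_comm (x j)]
  calc ∑ i, ∑ j, A i j * (x i + x j) ^ 2
      = ∑ i, ∑ j, A i j * (x i + x j) * x i + ∑ i, ∑ j, A i j * (x i + x j) * x j := by
        simp only [← Finset.sum_add_distrib]
        refine Finset.sum_congr rfl fun i _ => Finset.sum_congr rfl fun j _ => ?_
        ring
    _ = 2 * ∑ i, ∑ j, A i j * (x i + x j) * x i := by rw [hswap, two_mul]
    _ = _ := by
        simp only [dotProduct, signlessLaplacian_mulVec_apply, Finset.mul_sum]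
        refine Finset.sum_congr rfl fun i _ => Finset.sum_congr rfl fun j _ => ?_
        ring

/-- The kernel of the signless Laplacian consists of the vectors changing sign along each edge. -/
lemma signlessLaplacian_mulVec_eq_zero_iff (hsymm : A.IsSymm) (hnonneg : ∀ i j, 0 ≤ A i j)
    (x : V → ℝ) :
    (Matrix.diagonal (fun i => ∑ j, A i j) + A) *ᵥ x = 0 ↔
      ∀ i j, 0 < A i j → x i + x j = 0 := by
  constructor
  · intro hx i j hij
    have hsum := sum_mul_add_sq_eq_signlessLaplacian hsymm x
    have hterm : ∀ i j, 0 ≤ A i j * (x i + x j) ^ 2 :=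
      fun i j => mul_nonneg (hnonneg i j) (sq_nonneg _)
    rw [hx, dotProduct_zero, mul_zero,
      Finset.sum_eq_zero_iff_of_nonneg fun i _ => Finset.sum_nonneg fun j _ => hterm i j] at hsum
    have hrow := hsum i (Finset.mem_univ i)
    rw [Finset.sum_eq_zero_iff_of_nonneg fun j _ => hterm i j] at hrow
    simpa [hij.ne'] using hrow j (Finset.mem_univ j)
  · intro hx
    ext i
    rw [signlessLaplacian_mulVec_apply]
    refine Finset.sum_eq_zero fun j _ => ?_
    rcases (hnonneg i j).eq_or_lt with h | h
    · rw [← h, zero_mul]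
    · rw [hx i j h, mul_zero]

end SignlessLaplacian

lemma SimpleGraph.Connected.ne_zero_of_adj_add_eq_zero {V : Type*} {G : SimpleGraph V}
    (hG : G.Connected) {x : V → ℝ} (hx : x ≠ 0) (hadj : ∀ i j, G.Adj i j → x i + x j = 0)
    (i : V) : x i ≠ 0 := by
  intro hi
  refine hx (funext fun j => ?_)
  obtain ⟨p⟩ := hG.preconnected i j
  induction p with
  | nil => exact hi
  | cons h _ ih => exact ih (by linarith [hadj _ _ h])

/-- For a weighted adjacency matrix `A` on `n ≥ 1` vertices with connected
support graph and signless Laplacian `Q = D + A`: `Q` is singular (has a nonzero kernel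
vector) if and only if the support graph of `A` is bipartite. -/
theorem signless_laplacian_singular_iff_bipartite
    (n : ℕ) (hn : 1 ≤ n) (A : Matrix (Fin n) (Fin n) ℝ)
    (hsymm : A.IsSymm) (hnonneg : ∀ i j, 0 ≤ A i j) (hdiag : ∀ i, A i i = 0)
    (hconn : (SimpleGraph.fromRel fun i j => 0 < A i j).Connected)
    (Q : Matrix (Fin n) (Fin n) ℝ)
    (hQ : Q = Matrix.diagonal (fun i => ∑ j, A i j) + A) :
    (∃ x : Fin n → ℝ, x ≠ 0 ∧ Q.mulVec x = 0) ↔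
      ∃ S : Set (Fin n), ∀ i j,
        (SimpleGraph.fromRel fun i j => 0 < A i j).Adj i j → (i ∈ S ↔ j ∉ S) := by
  classical
  have hadj : ∀ i j, (SimpleGraph.fromRel fun i j => 0 < A i j).Adj i j ↔ 0 < A i j := by
    intro i j
    rw [SimpleGraph.fromRel_adj, hsymm.apply i j, or_self, and_iff_right_iff_imp]
    rintro h rfl
    exact h.ne' (hdiag i)
  simp only [hQ, signlessLaplacian_mulVec_eq_zero_iff hsymm hnonneg]
  constructor
  · rintro ⟨x, hx, hker⟩
    have hedge : ∀ i j, (SimpleGraph.fromRel fun i j => 0 < A i j).Adj i j → x i + x j = 0 :=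
      fun i j h => hker i j ((hadj i j).1 h)
    refine ⟨{i | 0 < x i}, fun i j h => ?_⟩
    have hj := hconn.ne_zero_of_adj_add_eq_zero hx hedge j
    have hij := hedge i j h
    rw [Set.mem_ofPred_eq, Set.mem_ofPred_eq, not_lt]
    exact ⟨fun _ => by linarith, fun hle => by linarith [lt_of_le_of_ne hle hj]⟩
  · rintro ⟨S, hS⟩
    refine ⟨fun i => if i ∈ S then 1 else -1, fun h => ?_, fun i j h => ?_⟩
    · have h0 := congrFun h ⟨0, hn⟩
      by_cases hmem : (⟨0, hn⟩ : Fin n) ∈ S <;> simp [hmem] at h0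
    · have hij := hS i j ((hadj i j).2 h)
      by_cases hj : j ∈ S <;> simp [hij, hj]
end

section
/- Fix β > 0 and continuous functions K_1, …, K_N from [0,∞) to real m×p matrices, and define the filtered signals K_{F,i}(t) = ∫₀ᵗ e^{−β(t−s)} K_i(s) ds. Let t₀ ≥ 0 and T > 0. If the p×p matrix ∫_{t₀}^{t₀+T} Σ_{i=1}^{N} K_i(s)ᵀ K_i(s) ds is positive definite, then the p×p matrix ∫_{t₀}^{t₀+T} Σ_{i=1}^{N} K_{F,i}(s)ᵀ K_{F,i}(s) ds is also positive definite. -/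
open Matrix

/-- A low-pass filtered signal `y` of a continuous `f` solves `y' = f - β y` on `[0, ∞)`. -/
theorem hasDerivWithinAt_lowPass {f : ℝ → ℝ} (hf : ContinuousOn f (Set.Ici 0)) (β : ℝ)
    {t : ℝ} (ht : 0 ≤ t) :
    HasDerivWithinAt (fun u => ∫ s in (0 : ℝ)..u, Real.exp (-β * (u - s)) * f s)
      (f t - β * ∫ s in (0 : ℝ)..t, Real.exp (-β * (t - s)) * f s) (Set.Ici 0) t := by
  let g : ℝ → ℝ := fun s => Real.exp (β * s) * f (max s 0)
  have hg : Continuous g :=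
    (by fun_prop : Continuous fun s : ℝ => Real.exp (β * s)).mul
      (hf.comp_continuous (by fun_prop) fun s => le_max_right s 0)
  have hfactor : ∀ u ∈ Set.Ici (0 : ℝ),
      ∫ s in (0 : ℝ)..u, Real.exp (-β * (u - s)) * f s =
        Real.exp (-β * u) * ∫ s in (0 : ℝ)..u, g s := by
    intro u hu
    rw [← intervalIntegral.integral_const_mul]
    refine intervalIntegral.integral_congr fun s hs => ?_
    rw [Set.uIcc_of_le hu] at hs
    simp only [g, max_eq_left hs.1, ← mul_assoc, ← Real.exp_add]
    ring_nf
  have hexp : HasDerivAt (fun u : ℝ => Real.exp (-β * u)) (Real.exp (-β * t) * -β) t := by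
    simpa using ((hasDerivAt_id t).const_mul (-β)).exp
  have hint : HasDerivAt (fun u : ℝ => ∫ s in (0 : ℝ)..u, g s) (g t) t :=
    intervalIntegral.integral_hasDerivAt_right (hg.intervalIntegrable _ _)
      (hg.stronglyMeasurableAtFilter _ _) hg.continuousAt
  refine ((hexp.fun_mul hint).hasDerivWithinAt.congr hfactor (hfactor t ht)).congr_deriv ?_
  have hcancel : Real.exp (-β * t) * Real.exp (β * t) = 1 := by
    rw [← Real.exp_add]; simp
  rw [hfactor t ht]
  simp only [g, max_eq_left ht]
  linear_combination f t * hcancel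

/-- The quadratic form of an integrated Gram matrix is the integral of the squared norms. -/
theorem dotProduct_integral_gram_mulVec {m p N : ℕ} {G : Fin N → ℝ → Matrix (Fin m) (Fin p) ℝ}
    {a b : ℝ} (hab : a ≤ b) (hG : ∀ i j k, ContinuousOn (fun t => G i t j k) (Set.Icc a b))
    (x : Fin p → ℝ) :
    x ⬝ᵥ ((Matrix.of fun j k : Fin p => ∫ s in a..b, (∑ i, (G i s)ᵀ * G i s) j k) *ᵥ x) =
      ∫ s in a..b, ∑ i, (G i s *ᵥ x) ⬝ᵥ (G i s *ᵥ x) := by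
  have hentry : ∀ j k, ContinuousOn (fun s => (∑ i, (G i s)ᵀ * G i s) j k) (Set.uIcc a b) := by
    intro j k
    rw [Set.uIcc_of_le hab]
    simp only [Matrix.sum_apply, mul_apply, transpose_apply]
    exact continuousOn_finsetSum _ fun i _ => continuousOn_finsetSum _ fun l _ =>
      (hG i l j).mul (hG i l k)
  have hpoint : ∀ s, ∑ i, (G i s *ᵥ x) ⬝ᵥ (G i s *ᵥ x) =
      ∑ j, ∑ k, x j * ((∑ i, (G i s)ᵀ * G i s) j k * x k) := by
    intro s
    calc ∑ i, (G i s *ᵥ x) ⬝ᵥ (G i s *ᵥ x)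
        = x ⬝ᵥ ((∑ i, (G i s)ᵀ * G i s) *ᵥ x) := by
          simp only [sum_mulVec, dotProduct_sum, ← mulVec_mulVec, dotProduct_mulVec,
            vecMul_transpose]
      _ = _ := by simp only [dotProduct, mulVec, Finset.mul_sum]
  have hterm : ∀ j k, IntervalIntegrable (fun s => x j * ((∑ i, (G i s)ᵀ * G i s) j k * x k))
      MeasureTheory.volume a b := fun j k =>
    ((hentry j k).intervalIntegrable.mul_const (x k)).const_mul (x j)
  have hrow : ∀ j, IntervalIntegrable
      (fun s => ∑ k, x j * ((∑ i, (G i s)ᵀ * G i s) j k * x k)) MeasureTheory.volume a b := by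
    intro j
    simpa only [Finset.sum_fn] using IntervalIntegrable.sum Finset.univ fun k _ => hterm j k
  simp only [hpoint]
  rw [intervalIntegral.integral_finsetSum fun j _ => hrow j]
  simp only [dotProduct, mulVec, of_apply, Finset.mul_sum]
  refine Finset.sum_congr rfl fun j _ => ?_
  rw [intervalIntegral.integral_finsetSum fun k _ => hterm j k]
  simp only [intervalIntegral.integral_const_mul, intervalIntegral.integral_mul_const]

/-- An integrated Gram matrix is positive definite iff no nonzero vector is annihilated by all
the regressors throughout the interval. -/
theorem posDef_integral_gram_iff {m p N : ℕ} {G : Fin N → ℝ → Matrix (Fin m) (Fin p) ℝ}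
    {a b : ℝ} (hab : a < b) (hG : ∀ i j k, ContinuousOn (fun t => G i t j k) (Set.Icc a b)) :
    (Matrix.of fun j k : Fin p => ∫ s in a..b, (∑ i, (G i s)ᵀ * G i s) j k).PosDef ↔
      ∀ x : Fin p → ℝ, (∀ s ∈ Set.Icc a b, ∀ i, G i s *ᵥ x = 0) → x = 0 := by
  rw [posDef_iff_dotProduct_mulVec]
  simp only [star_trivial, dotProduct_integral_gram_mulVec hab.le hG]
  constructor
  · rintro ⟨-, hpos⟩ x hx
    by_contra hne
    refine (hpos hne).ne' ?_
    rw [intervalIntegral.integral_congr (g := fun _ => 0)]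
    · simp
    · intro s hs
      rw [Set.uIcc_of_le hab.le] at hs
      simp [hx s hs]
  · refine fun h => ⟨?_, fun x hx => ?_⟩
    · ext j k
      simp [Matrix.sum_apply, mul_apply, mul_comm]
    · have hnonneg : ∀ s, ∀ i ∈ Finset.univ, 0 ≤ (G i s *ᵥ x) ⬝ᵥ (G i s *ᵥ x) :=
        fun s i _ => Finset.sum_nonneg fun _ _ => mul_self_nonneg _
      refine intervalIntegral.integral_pos hab ?_
        (fun s _ => Finset.sum_nonneg (hnonneg s)) ?_
      · have hmul : ∀ i l, ContinuousOn (fun s => (G i s *ᵥ x) l) (Set.Icc a b) :=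
          fun i l => continuousOn_finsetSum Finset.univ fun k _ =>
            (hG i l k).mul (continuousOn_const (c := x k))
        exact continuousOn_finsetSum _ fun i _ => continuousOn_finsetSum _ fun l _ =>
          (hmul i l).mul (hmul i l)
      · obtain ⟨s, hs, i, hi⟩ : ∃ s ∈ Set.Icc a b, ∃ i, G i s *ᵥ x ≠ 0 := by
          by_contra! hcon
          exact hx (h x hcon)
        exact ⟨s, hs, Finset.sum_pos' (hnonneg s) ⟨i, Finset.mem_univ i,
          (hnonneg s i (Finset.mem_univ i)).lt_of_ne' (mt dotProduct_self_eq_zero.mp hi)⟩⟩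

/-- If the set of regressors `K₁, …, K_N` is collectively initially
exciting over `[t₀, t₀+T]` (the integral of `Σᵢ Kᵢᵀ Kᵢ` is positive definite), then so is
the set of low-pass filtered regressors `K_{F,i}(t) = ∫₀ᵗ e^{−β(t−s)} Kᵢ(s) ds`. -/
theorem filtered_regressors_CIE_of_CIE
    (m p N : ℕ) (β : ℝ) (hβ : 0 < β)
    (K : Fin N → ℝ → Matrix (Fin m) (Fin p) ℝ)
    (hKc : ∀ i a b, ContinuousOn (fun t => K i t a b) (Set.Ici 0))
    (KF : Fin N → ℝ → Matrix (Fin m) (Fin p) ℝ)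
    (hKF : ∀ i t a b, KF i t a b = ∫ s in (0:ℝ)..t, Real.exp (-β * (t - s)) * K i s a b)
    (t₀ T : ℝ) (ht₀ : 0 ≤ t₀) (hT : 0 < T)
    (hPD : Matrix.PosDef
      (Matrix.of fun a b : Fin p => ∫ s in t₀..t₀ + T, (∑ i, (K i s)ᵀ * K i s) a b)) :
    Matrix.PosDef
      (Matrix.of fun a b : Fin p => ∫ s in t₀..t₀ + T, (∑ i, (KF i s)ᵀ * KF i s) a b) := by
  have hsub : Set.Icc t₀ (t₀ + T) ⊆ Set.Ici 0 := fun s hs => ht₀.trans hs.1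
  have hlt : t₀ < t₀ + T := lt_add_of_pos_right t₀ hT
  have hderiv : ∀ i a b, ∀ t ∈ Set.Icc t₀ (t₀ + T),
      HasDerivWithinAt (fun u => KF i u a b) (K i t a b - β * KF i t a b)
        (Set.Icc t₀ (t₀ + T)) t := by
    intro i a b t ht
    simp only [hKF]
    exact (hasDerivWithinAt_lowPass (hKc i a b) β (hsub ht)).mono hsub
  rw [posDef_integral_gram_iff hlt fun i a b => (hKc i a b).mono hsub] at hPD
  rw [posDef_integral_gram_iff hlt fun i a b t ht => (hderiv i a b t ht).continuousWithinAt]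
  refine fun x hx => hPD x fun t ht i => funext fun a => ?_
  have hfiltered : HasDerivWithinAt (fun u => (KF i u *ᵥ x) a)
      (∑ b, (K i t a b - β * KF i t a b) * x b) (Set.Icc t₀ (t₀ + T)) t :=
    HasDerivWithinAt.fun_sum (u := Finset.univ) fun b _ => (hderiv i a b t ht).mul_const (x b)
  have hzero : HasDerivWithinAt (fun u => (KF i u *ᵥ x) a) 0 (Set.Icc t₀ (t₀ + T)) t :=
    (hasDerivWithinAt_const t _ (0 : ℝ)).congr (fun u hu => by simp [hx u hu i])
      (by simp [hx t ht i])
  have hsum := (uniqueDiffOn_Icc hlt t ht).eq_deriv _ hfiltered hzero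
  have hKFx : ∑ b, KF i t a b * x b = 0 := congrFun (hx t ht i) a
  simp only [sub_mul, Finset.sum_sub_distrib, mul_assoc, ← Finset.mul_sum, hKFx, mul_zero,
    sub_zero] at hsum
  exact hsum
end

section
/- Let G be a connected simple graph on n ≥ 1 vertices with Laplacian matrix L = D − A, let d ≥ 1, and for each vertex i let B_i be a symmetric positive semidefinite real d×d matrix such that Σ_{i=1}^{n} B_i is positive definite. Then the (nd)×(nd) matrix L ⊗ I_d + blockdiag(B_1, …, B_n) is positive definite. -/
open Matrix

section QuadraticForms

variable {ι κ R : Type*} [Fintype ι] [Fintype κ] [CommSemiring R]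

/-- The quadratic form of `A ⊗ I` is the sum of the quadratic forms of `A` on the slices. -/
lemma dotProduct_kroneckerMap_one_mulVec [DecidableEq κ] (A : Matrix ι ι R) (x : ι × κ → R) :
    x ⬝ᵥ (Matrix.kroneckerMap (· * ·) A (1 : Matrix κ κ R) *ᵥ x) =
      ∑ k, (fun i => x (i, k)) ⬝ᵥ (A *ᵥ fun i => x (i, k)) := by
  simp only [dotProduct, mulVec, Fintype.sum_prod_type, kroneckerMap_apply, one_apply, mul_ite,
    mul_one, mul_zero, ite_mul, zero_mul, Finset.sum_ite_eq, Finset.mem_univ, if_true]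
  exact Finset.sum_comm

/-- The quadratic form of a block-diagonal matrix is the sum of the quadratic forms of its blocks
on the corresponding parts of the vector. -/
lemma dotProduct_blockDiag_mulVec [DecidableEq ι] (B : ι → Matrix κ κ R) (x : ι × κ → R) :
    x ⬝ᵥ ((Matrix.of fun p q : ι × κ => if p.1 = q.1 then B p.1 p.2 q.2 else 0) *ᵥ x) =
      ∑ i, (fun k => x (i, k)) ⬝ᵥ (B i *ᵥ fun k => x (i, k)) := by
  simp only [dotProduct, mulVec, Fintype.sum_prod_type, of_apply, ite_mul, zero_mul]
  refine Finset.sum_congr rfl fun i _ => Finset.sum_congr rfl fun k _ => ?_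
  rw [Finset.sum_eq_single i] <;> simp +contextual [eq_comm]

end QuadraticForms

/-- For a connected simple graph `G` on `n ≥ 1` vertices with Laplacian
`L`, and symmetric positive semidefinite `d × d` blocks `B₁, …, Bₙ` whose sum is positive
definite, the matrix `L ⊗ I_d + blockdiag(B₁, …, Bₙ)` is positive definite. -/
theorem laplacian_kron_plus_blockdiag_posDef
    (n d : ℕ) (hn : 1 ≤ n) (hd : 1 ≤ d)
    (G : SimpleGraph (Fin n)) [DecidableRel G.Adj] (hG : G.Connected)
    (B : Fin n → Matrix (Fin d) (Fin d) ℝ)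
    (hB : ∀ i, (B i).PosSemidef) (hBsum : (∑ i, B i).PosDef) :
    Matrix.PosDef
      (Matrix.kroneckerMap (· * ·) (G.lapMatrix ℝ) (1 : Matrix (Fin d) (Fin d) ℝ) +
        Matrix.of fun pq qr : Fin n × Fin d =>
          if pq.1 = qr.1 then B pq.1 pq.2 qr.2 else 0) := by
  have hL := G.posSemidef_lapMatrix ℝ
  refine .of_dotProduct_mulVec_pos (.add ?_ ?_) fun x hx => ?_
  · ext ⟨i, k⟩ ⟨j, l⟩
    simp [(G.isSymm_lapMatrix ℝ).apply i j, one_apply, eq_comm (a := l)]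
  · ext ⟨i, k⟩ ⟨j, l⟩
    by_cases h : i = j
    · subst h
      simpa using (hB i).isHermitian.apply k l
    · simp [h, Ne.symm h]
  · rw [star_trivial, add_mulVec, dotProduct_add, dotProduct_kroneckerMap_one_mulVec,
      dotProduct_blockDiag_mulVec]
    have hLnn (k : Fin d) :
        0 ≤ (fun i => x (i, k)) ⬝ᵥ (G.lapMatrix ℝ *ᵥ fun i => x (i, k)) := by
      simpa only [star_trivial] using hL.dotProduct_mulVec_nonneg fun i => x (i, k)
    have hBnn (i : Fin n) : 0 ≤ (fun k => x (i, k)) ⬝ᵥ (B i *ᵥ fun k => x (i, k)) := by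
      simpa only [star_trivial] using (hB i).dotProduct_mulVec_nonneg fun k => x (i, k)
    have hLsum := Finset.sum_nonneg fun k (_ : k ∈ Finset.univ) => hLnn k
    have hBsum_nonneg := Finset.sum_nonneg fun i (_ : i ∈ Finset.univ) => hBnn i
    refine (add_nonneg hLsum hBsum_nonneg).lt_of_ne' fun h0 => hx ?_
    obtain ⟨hL0, hB0⟩ := (add_eq_zero_iff_of_nonneg hLsum hBsum_nonneg).1 h0
    -- `x` is constant along vertices, because every slice lies in the kernel of the Laplacian.
    have hconst (i j : Fin n) (k : Fin d) : x (i, k) = x (j, k) := by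
      have hk := (Finset.sum_eq_zero_iff_of_nonneg fun k _ => hLnn k).1 hL0 k (Finset.mem_univ k)
      rw [← toLinearMap₂'_apply',
        G.lapMatrix_toLinearMap₂'_apply'_eq_zero_iff_forall_reachable] at hk
      exact hk i j (hG.preconnected i j)
    obtain ⟨i₀⟩ := hG.nonempty
    have hy : (fun k => x (i₀, k)) = 0 := by
      by_contra hne
      refine (hBsum.dotProduct_mulVec_pos hne).ne' ?_
      rw [star_trivial, sum_mulVec, dotProduct_sum, ← hB0]
      refine Finset.sum_congr rfl fun i _ => ?_
      rw [funext fun k => hconst i i₀ k]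
    ext ⟨i, k⟩
    rw [hconst i i₀ k]
    exact congrFun hy k
end

section
/- Let T > 0, let Q be a continuous function from [0,T] to real n×n matrices such that Q(t) is symmetric positive semidefinite for every t ∈ [0,T], and let k : [0,T] → ℝ be continuous. If the matrix ∫₀ᵀ k(t)² Q(t)² dt is positive definite, then the matrix ∫₀ᵀ Q(t) dt is positive definite. -/
open Matrix

/-- The quadratic form of an entrywise integral is the integral of the quadratic forms. -/
theorem dotProduct_integral_mulVec {ι : Type*} [Fintype ι] {a b : ℝ} {A : ℝ → Matrix ι ι ℝ}
    (hA : ∀ i j, IntervalIntegrable (fun t => A t i j) MeasureTheory.volume a b) (x : ι → ℝ) :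
    x ⬝ᵥ ((Matrix.of fun i j => ∫ t in a..b, A t i j) *ᵥ x) =
      ∫ t in a..b, x ⬝ᵥ (A t *ᵥ x) := by
  simp only [dotProduct, mulVec, of_apply]
  rw [intervalIntegral.integral_finsetSum fun i _ => ?_]
  · refine Finset.sum_congr rfl fun i _ => ?_
    rw [intervalIntegral.integral_const_mul,
      intervalIntegral.integral_finsetSum fun j _ => (hA i j).mul_const (x j)]
    simp only [intervalIntegral.integral_mul_const]
  · exact IntervalIntegrable.const_mul
      (by simpa only [Finset.sum_fn] using
        IntervalIntegrable.sum Finset.univ fun j _ => (hA i j).mul_const (x j)) (x i)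

/-- If `Q(t)` is symmetric positive semidefinite for each `t ∈ [0,T]`,
`k` is continuous, and `∫₀ᵀ k(t)² Q(t)² dt` is positive definite, then `∫₀ᵀ Q(t) dt`
is positive definite. -/
theorem integral_posDef_of_integral_sq_posDef
    (n : ℕ) (T : ℝ) (hT : 0 < T)
    (Q : ℝ → Matrix (Fin n) (Fin n) ℝ)
    (hQc : ∀ i j, ContinuousOn (fun t => Q t i j) (Set.Icc 0 T))
    (hQpsd : ∀ t ∈ Set.Icc (0:ℝ) T, (Q t).PosSemidef)
    (k : ℝ → ℝ) (hk : ContinuousOn k (Set.Icc 0 T))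
    (hPD : Matrix.PosDef
      (Matrix.of fun i j : Fin n => ∫ t in (0:ℝ)..T, k t ^ 2 * (Q t * Q t) i j)) :
    Matrix.PosDef (Matrix.of fun i j : Fin n => ∫ t in (0:ℝ)..T, Q t i j) := by
  have hQint (i j) : IntervalIntegrable (fun t => Q t i j) MeasureTheory.volume 0 T :=
    (hQc i j).intervalIntegrable_of_Icc hT.le
  have hsqint (i j) : IntervalIntegrable (fun t => (k t ^ 2 • (Q t * Q t)) i j)
      MeasureTheory.volume 0 T := by
    refine ContinuousOn.intervalIntegrable_of_Icc hT.le ?_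
    simp only [Matrix.smul_apply, mul_apply, smul_eq_mul]
    exact (hk.pow 2).mul (continuousOn_finsetSum _ fun l _ => (hQc i l).mul (hQc l j))
  refine posDef_iff_dotProduct_mulVec.2 ⟨?_, fun x hx => ?_⟩
  · ext i j
    simp only [conjTranspose_apply, of_apply, star_trivial]
    refine intervalIntegral.integral_congr fun t ht => ?_
    rw [Set.uIcc_of_le hT.le] at ht
    simpa using (hQpsd t ht).isHermitian.apply i j
  have hsq := (posDef_iff_dotProduct_mulVec.1 hPD).2 hx
  rw [star_trivial] at hsq ⊢
  rw [dotProduct_integral_mulVec hQint]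
  have hnonneg (t) (ht : t ∈ Set.Icc 0 T) : 0 ≤ x ⬝ᵥ (Q t *ᵥ x) := by
    simpa using (hQpsd t ht).dotProduct_mulVec_nonneg x
  have hcont : ContinuousOn (fun t => x ⬝ᵥ (Q t *ᵥ x)) (Set.Icc 0 T) := by
    simp only [dotProduct, mulVec]
    exact continuousOn_finsetSum _ fun i _ => continuousOn_const.mul
      (continuousOn_finsetSum _ fun j _ => (hQc i j).mul continuousOn_const)
  refine intervalIntegral.integral_pos hT hcont
    (fun t ht => hnonneg t (Set.Ioc_subset_Icc_self ht)) ?_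
  by_contra! hle
  refine hsq.ne' ((dotProduct_integral_mulVec hsqint x).trans ?_)
  refine intervalIntegral.integral_zero_ae (Filter.Eventually.of_forall fun t ht => ?_)
  rw [Set.uIoc_of_le hT.le] at ht
  have ht' := Set.Ioc_subset_Icc_self ht
  have hker : Q t *ᵥ x = 0 := ((hQpsd t ht').dotProduct_mulVec_zero_iff x).1
    (by simpa using le_antisymm (hle t ht') (hnonneg t ht'))
  rw [smul_mulVec, ← mulVec_mulVec, hker]
  simp
end

section
/- Let T > 0 and for each t ∈ [0,T] let A(t) be a weighted adjacency matrix on n ≥ 1 vertices (symmetric, nonnegative entries, zero diagonal), depending continuously on t, with signless Laplacian Q(t) = D(t) + A(t). Let k : [0,T] → ℝ be continuous, and let Ā = ∫₀ᵀ A(t) dt be the union adjacency matrix. If the matrix ∫₀ᵀ k(t)² Q(t)² dt is positive definite and the support graph of Ā is connected, then the support graph of Ā is not bipartite. -/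
open Matrix

/-- A nonnegative continuous function on `[a, b]` with nonpositive integral vanishes on `[a, b]`. -/
theorem eq_zero_of_intervalIntegral_nonpos {f : ℝ → ℝ} {a b : ℝ} (hab : a < b)
    (hf : ContinuousOn f (Set.Icc a b)) (hf0 : ∀ t ∈ Set.Icc a b, 0 ≤ f t)
    (hint : ∫ t in a..b, f t ≤ 0) {t : ℝ} (ht : t ∈ Set.Icc a b) : f t = 0 := by
  by_contra hne
  exact hint.not_gt <| intervalIntegral.integral_pos hab hf
    (fun s hs => hf0 s (Set.Ioc_subset_Icc_self hs)) ⟨t, ht, (hf0 t ht).lt_of_ne' hne⟩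

/-- The signless Laplacian annihilates a vector taking opposite values at the endpoints of every
edge. -/
theorem signlessLaplacian_mulVec_eq_zero {ι R : Type*} [Fintype ι] [DecidableEq ι] [CommRing R]
    {A : Matrix ι ι R} {x : ι → R} (h : ∀ i j, A i j * (x i + x j) = 0) :
    (Matrix.diagonal (fun i => ∑ j, A i j) + A) *ᵥ x = 0 := by
  ext i
  rw [Matrix.add_mulVec, Pi.add_apply, Matrix.mulVec_diagonal, Matrix.mulVec, dotProduct,
    Finset.sum_mul, ← Finset.sum_add_distrib]
  exact Finset.sum_eq_zero fun j _ => by rw [← mul_add, h]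

/-- A vector killed by `M t` for all `t ∈ [a, b]` is killed by the entrywise integral of `M`. -/
theorem integral_mulVec_eq_zero {ι : Type*} [Fintype ι] {a b : ℝ} (hab : a ≤ b)
    {M : ℝ → Matrix ι ι ℝ} (hM : ∀ i j, ContinuousOn (fun t => M t i j) (Set.Icc a b))
    {x : ι → ℝ} (hx : ∀ t ∈ Set.Icc a b, M t *ᵥ x = 0) :
    (Matrix.of fun i j => ∫ t in a..b, M t i j) *ᵥ x = 0 := by
  ext i
  simp only [Matrix.mulVec, dotProduct, Matrix.of_apply, Pi.zero_apply,
    ← intervalIntegral.integral_mul_const]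
  rw [← intervalIntegral.integral_finsetSum fun j _ =>
    ((hM i j).intervalIntegrable_of_Icc hab).mul_const (x j)]
  refine intervalIntegral.integral_zero_ae (Filter.Eventually.of_forall fun t ht => ?_)
  rw [Set.uIoc_of_le hab] at ht
  exact congrFun (hx t (Set.Ioc_subset_Icc_self ht)) i

/-- Let `A(t)`, `t ∈ [0,T]`, be a continuously varying family of weighted
adjacency matrices with signless Laplacians `Q(t)`, and let `Ā = ∫₀ᵀ A(t) dt` be the union
adjacency matrix. If `∫₀ᵀ k(t)² Q(t)² dt` is positive definite and the support graph of `Ā`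
is connected, then the support graph of `Ā` is not bipartite. -/
theorem union_graph_not_bipartite_of_integral_posDef
    (n : ℕ) (hn : 1 ≤ n) (T : ℝ) (hT : 0 < T)
    (A : ℝ → Matrix (Fin n) (Fin n) ℝ)
    (hAc : ∀ i j, ContinuousOn (fun t => A t i j) (Set.Icc 0 T))
    (hsymm : ∀ t ∈ Set.Icc (0:ℝ) T, (A t).IsSymm)
    (hnonneg : ∀ t ∈ Set.Icc (0:ℝ) T, ∀ i j, 0 ≤ A t i j)
    (hdiag : ∀ t ∈ Set.Icc (0:ℝ) T, ∀ i, A t i i = 0)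
    (Q : ℝ → Matrix (Fin n) (Fin n) ℝ)
    (hQ : ∀ t, Q t = Matrix.diagonal (fun i => ∑ j, A t i j) + A t)
    (k : ℝ → ℝ) (hk : ContinuousOn k (Set.Icc 0 T))
    (Abar : Matrix (Fin n) (Fin n) ℝ)
    (hAbar : ∀ i j, Abar i j = ∫ t in (0:ℝ)..T, A t i j)
    (hPD : Matrix.PosDef
      (Matrix.of fun i j : Fin n => ∫ t in (0:ℝ)..T, k t ^ 2 * (Q t * Q t) i j))
    (hconn : (SimpleGraph.fromRel fun i j => 0 < Abar i j).Connected) :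
    ¬ ∃ S : Set (Fin n), ∀ i j,
        (SimpleGraph.fromRel fun i j => 0 < Abar i j).Adj i j → (i ∈ S ↔ j ∉ S) := by
  classical
  rintro ⟨S, hS⟩
  set x : Fin n → ℝ := fun i => if i ∈ S then 1 else -1 with hx
  have hedge : ∀ t ∈ Set.Icc (0:ℝ) T, ∀ i j, A t i j * (x i + x j) = 0 := by
    intro t ht i j
    rcases eq_or_ne i j with rfl | hij
    · rw [hdiag t ht, zero_mul]
    · by_cases hpos : 0 < Abar i j
      · have hiff := hS i j ((SimpleGraph.fromRel_adj _ _ _).2 ⟨hij, Or.inl hpos⟩)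
        by_cases hj : j ∈ S <;> simp [hx, hiff, hj]
      · rw [eq_zero_of_intervalIntegral_nonpos hT (hAc i j) (fun s hs => hnonneg s hs i j)
          (hAbar i j ▸ not_lt.1 hpos) ht, zero_mul]
  have hQx : ∀ t ∈ Set.Icc (0:ℝ) T, Q t *ᵥ x = 0 := fun t ht => by
    rw [hQ, signlessLaplacian_mulVec_eq_zero (hedge t ht)]
  have hQc : ∀ i j, ContinuousOn (fun t => Q t i j) (Set.Icc 0 T) := by
    intro i j
    simp only [hQ, Matrix.add_apply, Matrix.diagonal_apply]
    refine ContinuousOn.add ?_ (hAc i j)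
    split_ifs
    · exact continuousOn_finsetSum _ fun l _ => hAc i l
    · exact continuousOn_const
  have hMx := integral_mulVec_eq_zero (M := fun t => k t ^ 2 • (Q t * Q t)) (x := x) hT.le
    (fun i j => by
      simp only [Matrix.smul_apply, Matrix.mul_apply, smul_eq_mul]
      exact (hk.pow 2).mul (continuousOn_finsetSum _ fun l _ => (hQc i l).mul (hQc l j)))
    (fun t ht => by
      rw [Matrix.smul_mulVec, ← Matrix.mulVec_mulVec, hQx t ht, Matrix.mulVec_zero, smul_zero])
  have hx0 : x = 0 :=
    Matrix.mulVec_injective_of_isUnit hPD.isUnit (hMx.trans (Matrix.mulVec_zero _).symm)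
  have hval := congrFun hx0 ⟨0, hn⟩
  simp only [hx, Pi.zero_apply] at hval
  split_ifs at hval <;> norm_num at hval
end

section
/- Let N be a continuous function from [0,∞) to real k×p matrices that is bounded (there is c ≥ 0 with N(t)N(t)ᵀ ≤ c·I_k in the Loewner order for all t ≥ 0) and persistently exciting: there exist μ₁ > 0 and T > 0 such that ∫_t^{t+T} N(τ)N(τ)ᵀ dτ ≥ μ₁ I_k in the Loewner order for all t ≥ 0. Then for every σ > 0 there exist constants γ ≥ 1 and λ > 0 such that every differentiable function x : [0,∞) → ℝ^k satisfying x′(t) = −σ N(t)N(t)ᵀ x(t) for all t ≥ 0 obeys ‖x(t)‖ ≤ γ e^{−λ(t−t₀)} ‖x(t₀)‖ for all t ≥ t₀ ≥ 0; that is, the origin of the system x′ = −σ N(t)N(t)ᵀ x is uniformly exponentially stable. -/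
open Matrix

/-- Derivative of the squared Euclidean distance from a curve to a fixed point. -/
lemma hasDerivAt_dotProduct_sub_self {ι : Type*} [Fintype ι] {x : ℝ → ι → ℝ} {x' : ι → ℝ} {t : ℝ}
    (hx : HasDerivAt x x' t) (v : ι → ℝ) :
    HasDerivAt (fun s => (x s - v) ⬝ᵥ (x s - v)) (2 * ((x t - v) ⬝ᵥ x')) t := by
  have h := hasDerivAt_pi.1 hx
  have := HasDerivAt.fun_sum (u := Finset.univ)
    fun i _ => ((h i).sub_const (v i)).fun_mul ((h i).sub_const (v i))
  refine this.congr_deriv ?_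
  simp only [dotProduct, Finset.mul_sum, Pi.sub_apply]
  exact Finset.sum_congr rfl fun i _ => by ring

lemma dotProduct_mul_transpose_mulVec {m n : Type*} [Fintype m] [Fintype n]
    (M : Matrix m n ℝ) (v w : m → ℝ) :
    v ⬝ᵥ (M * Mᵀ) *ᵥ w = (Mᵀ *ᵥ v) ⬝ᵥ (Mᵀ *ᵥ w) := by
  rw [← mulVec_mulVec, dotProduct_mulVec, ← mulVec_transpose]

lemma dotProduct_self_nonneg_real {ι : Type*} [Fintype ι] (v : ι → ℝ) : 0 ≤ v ⬝ᵥ v :=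
  Finset.sum_nonneg fun i _ => mul_self_nonneg (v i)

lemma transpose_mulVec_dotProduct_self_le {m n : Type*} [Fintype m] [DecidableEq m] [Fintype n]
    {M : Matrix m n ℝ} {c : ℝ} (h : (c • (1 : Matrix m m ℝ) - M * Mᵀ).PosSemidef) (v : m → ℝ) :
    (Mᵀ *ᵥ v) ⬝ᵥ (Mᵀ *ᵥ v) ≤ c * (v ⬝ᵥ v) := by
  have := h.dotProduct_mulVec_nonneg v
  simp only [star_trivial, sub_mulVec, smul_mulVec, one_mulVec, dotProduct_sub, dotProduct_smul,
    smul_eq_mul, dotProduct_mul_transpose_mulVec] at this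
  linarith

lemma dotProduct_sub_self_le {ι : Type*} [Fintype ι] (u w : ι → ℝ) :
    (u - w) ⬝ᵥ (u - w) ≤ 2 * (u ⬝ᵥ u) + 2 * (w ⬝ᵥ w) := by
  have := dotProduct_self_nonneg_real (u + w)
  simp only [add_dotProduct, sub_dotProduct, dotProduct_add, dotProduct_sub] at this ⊢
  linarith

lemma neg_two_mul_dotProduct_le {ι : Type*} [Fintype ι] (σ : ℝ) (u w : ι → ℝ) :
    -(2 * σ * (u ⬝ᵥ w)) ≤ u ⬝ᵥ u + σ ^ 2 * (w ⬝ᵥ w) := by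
  have := dotProduct_self_nonneg_real (u + σ • w)
  simp only [add_dotProduct, dotProduct_add, dotProduct_smul, smul_dotProduct, smul_eq_mul,
    dotProduct_comm w u] at this
  linarith

section GradientFlow

variable {k p : ℕ} {N : ℝ → Matrix (Fin k) (Fin p) ℝ} {x : ℝ → Fin k → ℝ} {σ c : ℝ}

/-- Along a solution, the derivative of the squared distance to a fixed point `v`. -/
lemma hasDerivAt_sq_dist_of_gradient_flow {t : ℝ}
    (hx : HasDerivAt x (-(σ • (N t * (N t)ᵀ)).mulVec (x t)) t) (v : Fin k → ℝ) :
    HasDerivAt (fun s => (x s - v) ⬝ᵥ (x s - v))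
      (-(2 * σ * (((N t)ᵀ *ᵥ (x t - v)) ⬝ᵥ ((N t)ᵀ *ᵥ x t)))) t := by
  refine (hasDerivAt_dotProduct_sub_self hx v).congr_deriv ?_
  rw [dotProduct_neg, smul_mulVec, dotProduct_smul, dotProduct_mul_transpose_mulVec, smul_eq_mul]
  ring

lemma hasDerivAt_sq_norm_of_gradient_flow {t : ℝ}
    (hx : HasDerivAt x (-(σ • (N t * (N t)ᵀ)).mulVec (x t)) t) :
    HasDerivAt (fun s => x s ⬝ᵥ x s)
      (-(2 * σ * (((N t)ᵀ *ᵥ x t) ⬝ᵥ ((N t)ᵀ *ᵥ x t)))) t := by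
  simpa using hasDerivAt_sq_dist_of_gradient_flow hx 0

lemma antitoneOn_sq_norm_of_gradient_flow (hσ : 0 < σ)
    (hx : ∀ t ≥ (0:ℝ), HasDerivAt x (-(σ • (N t * (N t)ᵀ)).mulVec (x t)) t) :
    AntitoneOn (fun s => x s ⬝ᵥ x s) (Set.Ici 0) := by
  have hd := fun t ht => hasDerivAt_sq_norm_of_gradient_flow (hx t ht)
  refine antitoneOn_of_hasDerivWithinAt_nonpos (convex_Ici 0)
    (fun t ht => (hd t ht).continuousAt.continuousWithinAt)
    (fun t ht => (hd t (interior_subset ht)).hasDerivWithinAt) fun t _ => ?_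
  have := dotProduct_self_nonneg_real ((N t)ᵀ *ᵥ x t)
  rw [neg_nonpos]
  positivity

/-- The displacement of a solution is controlled by the decrease of its squared norm. -/
lemma sq_dist_le_of_gradient_flow (hc : 0 ≤ c)
    (hbd : ∀ t ≥ (0:ℝ), (c • (1 : Matrix (Fin k) (Fin k) ℝ) - N t * (N t)ᵀ).PosSemidef)
    (hx : ∀ t ≥ (0:ℝ), HasDerivAt x (-(σ • (N t * (N t)ᵀ)).mulVec (x t)) t)
    {t s : ℝ} (ht : 0 ≤ t) (hts : t ≤ s) :
    (x s - x t) ⬝ᵥ (x s - x t) ≤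
      Real.exp (c * (s - t)) * (σ / 2 * (x t ⬝ᵥ x t - x s ⬝ᵥ x s)) := by
  have hd : ∀ r ∈ Set.Ici t, HasDerivAt
      (fun r => Real.exp (-(c * (r - t))) * ((x r - x t) ⬝ᵥ (x r - x t)) +
        σ / 2 * (x r ⬝ᵥ x r))
      (Real.exp (-(c * (r - t))) * (-(c * 1)) * ((x r - x t) ⬝ᵥ (x r - x t)) +
        Real.exp (-(c * (r - t))) *
          -(2 * σ * (((N r)ᵀ *ᵥ (x r - x t)) ⬝ᵥ ((N r)ᵀ *ᵥ x r))) +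
        σ / 2 * -(2 * σ * (((N r)ᵀ *ᵥ x r) ⬝ᵥ ((N r)ᵀ *ᵥ x r)))) r := fun r hr =>
    have hr0 := hx r (ht.trans hr)
    (((((hasDerivAt_id r).sub_const t).const_mul c).fun_neg.exp).fun_mul
      (hasDerivAt_sq_dist_of_gradient_flow hr0 (x t))).fun_add
      ((hasDerivAt_sq_norm_of_gradient_flow hr0).const_mul (σ / 2))
  have hanti : AntitoneOn (fun r => Real.exp (-(c * (r - t))) * ((x r - x t) ⬝ᵥ (x r - x t)) +
        σ / 2 * (x r ⬝ᵥ x r)) (Set.Ici t) := by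
    refine antitoneOn_of_hasDerivWithinAt_nonpos (convex_Ici t)
      (fun r hr => (hd r hr).continuousAt.continuousWithinAt)
      (fun r hr => (hd r (interior_subset hr)).hasDerivWithinAt) fun r hr => ?_
    have hr : t ≤ r := interior_subset hr
    have h₁ := neg_two_mul_dotProduct_le σ ((N r)ᵀ *ᵥ (x r - x t)) ((N r)ᵀ *ᵥ x r)
    have h₂ := transpose_mulVec_dotProduct_self_le (hbd r (ht.trans hr)) (x r - x t)
    have h₃ : Real.exp (-(c * (r - t))) ≤ 1 :=
      Real.exp_le_one_iff.2 (neg_nonpos.2 (mul_nonneg hc (sub_nonneg.2 hr)))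
    have h₄ := mul_nonneg (sq_nonneg σ) (dotProduct_self_nonneg_real ((N r)ᵀ *ᵥ x r))
    have h₅ := mul_le_mul_of_nonneg_left (h₁.trans (add_le_add_left h₂ _))
      (Real.exp_pos (-(c * (r - t)))).le
    have h₆ := mul_le_mul_of_nonneg_right h₃ h₄
    linarith
  have h := hanti Set.self_mem_Ici hts hts
  simp only [sub_self, mul_zero, zero_dotProduct, zero_add, Real.exp_neg] at h
  have he := Real.exp_pos (c * (s - t))
  rw [← inv_mul_le_iff₀ he]
  linarith

/-- Over one excitation window the squared norm drops by a definite proportion. -/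
lemma sq_norm_le_decrease_of_gradient_flow (hσ : 0 < σ) (hc : 0 ≤ c)
    (hNc : ∀ i j, ContinuousOn (fun t => N t i j) (Set.Ici 0))
    (hbd : ∀ t ≥ (0:ℝ), (c • (1 : Matrix (Fin k) (Fin k) ℝ) - N t * (N t)ᵀ).PosSemidef)
    {μ₁ T t : ℝ} (hT : 0 < T) (ht : 0 ≤ t)
    (hPE : ((Matrix.of fun i j : Fin k => ∫ τ in t..t + T, (N τ * (N τ)ᵀ) i j) -
        μ₁ • (1 : Matrix (Fin k) (Fin k) ℝ)).PosSemidef)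
    (hx : ∀ t ≥ (0:ℝ), HasDerivAt x (-(σ • (N t * (N t)ᵀ)).mulVec (x t)) t) :
    μ₁ * (x t ⬝ᵥ x t) ≤ (1 / σ + T * (c * σ * Real.exp (c * T))) *
      (x t ⬝ᵥ x t - x (t + T) ⬝ᵥ x (t + T)) := by
  have htT : t ≤ t + T := by linarith
  have hsub : Set.uIcc t (t + T) ⊆ Set.Ici 0 := by
    rw [Set.uIcc_of_le htT]
    exact fun s hs => ht.trans hs.1
  have hN : ContinuousOn N (Set.Ici 0) :=
    continuousOn_pi.2 fun i => continuousOn_pi.2 fun j => hNc i j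
  have hxc : ContinuousOn x (Set.Ici 0) := fun s hs => (hx s hs).continuousAt.continuousWithinAt
  have hNt : ContinuousOn (fun s => (N s)ᵀ) (Set.Ici 0) :=
    continuous_id.matrix_transpose.comp_continuousOn hN
  have hA : ContinuousOn (fun s => N s * (N s)ᵀ) (Set.Ici 0) :=
    (continuous_fst.matrix_mul continuous_snd).comp_continuousOn (hN.prodMk hNt)
  have hw : ContinuousOn (fun s => (N s)ᵀ *ᵥ x s) (Set.Ici 0) :=
    (continuous_fst.matrix_mulVec continuous_snd).comp_continuousOn (hNt.prodMk hxc)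
  have hww : ContinuousOn (fun s => ((N s)ᵀ *ᵥ x s) ⬝ᵥ ((N s)ᵀ *ᵥ x s)) (Set.Ici 0) :=
    (continuous_fst.dotProduct continuous_snd).comp_continuousOn (hw.prodMk hw)
  have hAij : ∀ i j, ContinuousOn (fun s => (N s * (N s)ᵀ) i j) (Set.Ici 0) := fun i j =>
    (continuous_id.matrix_elem i j).comp_continuousOn hA
  set v := x t
  have hq : ∫ s in t..t + T, v ⬝ᵥ (N s * (N s)ᵀ) *ᵥ v =
      v ⬝ᵥ (Matrix.of fun i j : Fin k => ∫ τ in t..t + T, (N τ * (N τ)ᵀ) i j) *ᵥ v := by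
    have hint : ∀ i j, IntervalIntegrable (fun s => (N s * (N s)ᵀ) i j)
        MeasureTheory.volume t (t + T) := fun i j => ((hAij i j).mono hsub).intervalIntegrable
    have hsum : ∀ i, IntervalIntegrable (fun s => ∑ j, (N s * (N s)ᵀ) i j * v j)
        MeasureTheory.volume t (t + T) := fun i =>
      (continuousOn_finsetSum _ fun j _ =>
        ((hAij i j).mono hsub).mul continuousOn_const).intervalIntegrable
    simp only [dotProduct, mulVec, of_apply]
    rw [intervalIntegral.integral_finsetSum fun i _ => (hsum i).const_mul (v i)]
    refine Finset.sum_congr rfl fun i _ => ?_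
    rw [intervalIntegral.integral_const_mul,
      intervalIntegral.integral_finsetSum fun j _ => (hint i j).mul_const _]
    simp only [intervalIntegral.integral_mul_const]
  have hqc : ContinuousOn (fun s => v ⬝ᵥ (N s * (N s)ᵀ) *ᵥ v) (Set.Ici 0) :=
    (continuous_const.dotProduct
      (continuous_id.matrix_mulVec continuous_const)).comp_continuousOn hA
  have hlow := hPE.dotProduct_mulVec_nonneg v
  simp only [star_trivial, sub_mulVec, smul_mulVec, one_mulVec, dotProduct_sub, dotProduct_smul,
    smul_eq_mul, ← hq] at hlow
  have hdiss : ∫ s in t..t + T, ((N s)ᵀ *ᵥ x s) ⬝ᵥ ((N s)ᵀ *ᵥ x s) =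
      (v ⬝ᵥ v - x (t + T) ⬝ᵥ x (t + T)) / (2 * σ) := by
    have h := intervalIntegral.integral_eq_sub_of_hasDerivAt
      (fun s hs => hasDerivAt_sq_norm_of_gradient_flow (hx s (hsub hs)))
      (((hww.mono hsub).intervalIntegrable.const_mul (2 * σ)).neg)
    rw [intervalIntegral.integral_neg, intervalIntegral.integral_const_mul] at h
    rw [eq_div_iff (by positivity)]
    linarith
  have hpt : ∀ s ∈ Set.Icc t (t + T), v ⬝ᵥ (N s * (N s)ᵀ) *ᵥ v ≤
      2 * (((N s)ᵀ *ᵥ x s) ⬝ᵥ ((N s)ᵀ *ᵥ x s)) +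
        c * σ * Real.exp (c * T) * (v ⬝ᵥ v - x (t + T) ⬝ᵥ x (t + T)) := by
    intro s hs
    have hs0 := ht.trans hs.1
    have h₁ := dotProduct_sub_self_le ((N s)ᵀ *ᵥ x s) ((N s)ᵀ *ᵥ (x s - v))
    rw [← mulVec_sub, sub_sub_cancel, ← dotProduct_mul_transpose_mulVec] at h₁
    have h₂ := transpose_mulVec_dotProduct_self_le (hbd s hs0) (x s - v)
    have h₃ := sq_dist_le_of_gradient_flow hc hbd hx ht hs.1
    have hanti := antitoneOn_sq_norm_of_gradient_flow hσ hx
    have h₄ : x (t + T) ⬝ᵥ x (t + T) ≤ x s ⬝ᵥ x s := hanti hs0 (hs0.trans hs.2) hs.2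
    have h₅ : x s ⬝ᵥ x s ≤ v ⬝ᵥ v := hanti ht hs0 hs.1
    have h₆ : Real.exp (c * (s - t)) * (σ / 2 * (v ⬝ᵥ v - x s ⬝ᵥ x s)) ≤
        Real.exp (c * T) * (σ / 2 * (v ⬝ᵥ v - x (t + T) ⬝ᵥ x (t + T))) := by
      have := sub_nonneg.2 h₅
      have := hs.2
      gcongr
      linarith
    have h₇ := mul_le_mul_of_nonneg_left (h₃.trans h₆) hc
    linarith
  have hwi : IntervalIntegrable (fun s => 2 * (((N s)ᵀ *ᵥ x s) ⬝ᵥ ((N s)ᵀ *ᵥ x s)))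
      MeasureTheory.volume t (t + T) := (hww.mono hsub).intervalIntegrable.const_mul 2
  have hmono := intervalIntegral.integral_mono_on (μ := MeasureTheory.volume) htT
    (hqc.mono hsub).intervalIntegrable (hwi.add intervalIntegrable_const) hpt
  rw [intervalIntegral.integral_add hwi
    intervalIntegrable_const, intervalIntegral.integral_const_mul, hdiss,
    intervalIntegral.integral_const, smul_eq_mul, add_sub_cancel_left] at hmono
  have hsimp : 2 * ((v ⬝ᵥ v - x (t + T) ⬝ᵥ x (t + T)) / (2 * σ)) =
      1 / σ * (v ⬝ᵥ v - x (t + T) ⬝ᵥ x (t + T)) := by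
    field_simp
  rw [hsimp] at hmono
  linarith

end GradientFlow

/-- A nonnegative nonincreasing function contracting by `ρ` over every window of length `T`
decays exponentially. -/
lemma le_exp_of_contraction {V : ℝ → ℝ} {ρ T : ℝ} (hT : 0 < T) (hρ : 0 < ρ) (hρ1 : ρ < 1)
    (hV : ∀ t, 0 ≤ V t) (hanti : AntitoneOn V (Set.Ici 0))
    (hstep : ∀ t ≥ (0:ℝ), V (t + T) ≤ ρ * V t) {t₀ t : ℝ} (ht₀ : 0 ≤ t₀) (ht : t₀ ≤ t) :
    V t ≤ ρ⁻¹ * Real.exp (Real.log ρ / T * (t - t₀)) * V t₀ := by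
  have hiter : ∀ n : ℕ, V (t₀ + n * T) ≤ ρ ^ n * V t₀ := by
    intro n
    induction n with
    | zero => simp
    | succ n ih =>
      have h := hstep (t₀ + n * T) (by positivity)
      calc V (t₀ + (n + 1 : ℕ) * T) = V (t₀ + n * T + T) := by push_cast; ring_nf
        _ ≤ ρ * (ρ ^ n * V t₀) := h.trans (by gcongr)
        _ = ρ ^ (n + 1) * V t₀ := by ring
  have hq : 0 ≤ (t - t₀) / T := div_nonneg (sub_nonneg.2 ht) hT.le
  set n := ⌊(t - t₀) / T⌋₊
  have hn : (n : ℝ) * T ≤ t - t₀ := (le_div_iff₀ hT).1 (Nat.floor_le hq)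
  have hn' : (t - t₀) / T ≤ n + 1 := (Nat.lt_floor_add_one _).le
  have hpow : ρ ^ n ≤ ρ⁻¹ * Real.exp (Real.log ρ / T * (t - t₀)) := by
    rw [← Real.exp_log hρ, Real.log_exp, ← Real.exp_neg, ← Real.exp_add, ← Real.exp_nat_mul,
      Real.exp_le_exp]
    have := mul_le_mul_of_nonpos_left hn' (Real.log_neg hρ hρ1).le
    calc n * Real.log ρ = -Real.log ρ + Real.log ρ * (n + 1) := by ring
      _ ≤ -Real.log ρ + Real.log ρ * ((t - t₀) / T) := by linarith
      _ = _ := by ring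
  calc V t ≤ V (t₀ + n * T) :=
        hanti (Set.mem_Ici.2 (by positivity)) (ht₀.trans ht) (by linarith)
    _ ≤ ρ ^ n * V t₀ := hiter n
    _ ≤ _ := mul_le_mul_of_nonneg_right hpow (hV t₀)

/-- If `N` is bounded (`N(t)N(t)ᵀ ≤ c I_k`) and persistently exciting
(`∫_t^{t+T} N(τ)N(τ)ᵀ dτ ≥ μ₁ I_k` for all `t ≥ 0`), then for every `σ > 0` the origin of
`x′ = −σ N(t)N(t)ᵀ x` is uniformly exponentially stable: there are `γ ≥ 1`, `λ > 0` with
`‖x(t)‖ ≤ γ e^{−λ(t−t₀)} ‖x(t₀)‖` for all solutions and all `t ≥ t₀ ≥ 0`. -/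
theorem pe_implies_uniform_exponential_stability
    (k p : ℕ) (N : ℝ → Matrix (Fin k) (Fin p) ℝ)
    (hNc : ∀ i j, ContinuousOn (fun t => N t i j) (Set.Ici 0))
    (c : ℝ) (hc : 0 ≤ c)
    (hbd : ∀ t ≥ (0:ℝ),
      (c • (1 : Matrix (Fin k) (Fin k) ℝ) - N t * (N t)ᵀ).PosSemidef)
    (μ₁ T : ℝ) (hμ : 0 < μ₁) (hT : 0 < T)
    (hPE : ∀ t ≥ (0:ℝ),
      ((Matrix.of fun i j : Fin k => ∫ τ in t..t + T, (N τ * (N τ)ᵀ) i j) -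
        μ₁ • (1 : Matrix (Fin k) (Fin k) ℝ)).PosSemidef) :
    ∀ σ > (0:ℝ), ∃ γ ≥ (1:ℝ), ∃ lam > (0:ℝ),
      ∀ x : ℝ → Fin k → ℝ,
        (∀ t ≥ (0:ℝ), HasDerivAt x (-(σ • (N t * (N t)ᵀ)).mulVec (x t)) t) →
        ∀ t₀ t : ℝ, 0 ≤ t₀ → t₀ ≤ t →
          Real.sqrt (∑ i, x t i ^ 2) ≤
            γ * Real.exp (-lam * (t - t₀)) * Real.sqrt (∑ i, x t₀ i ^ 2) := by
  intro σ hσ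
  set C := 1 / σ + T * (c * σ * Real.exp (c * T)) + μ₁ with hC
  have hCμ : μ₁ < C := by
    have : 0 < 1 / σ + T * (c * σ * Real.exp (c * T)) := by positivity
    linarith
  have hC0 : 0 < C := hμ.trans hCμ
  set ρ := 1 - μ₁ / C with hρdef
  have hρ : 0 < ρ := sub_pos.2 ((div_lt_one hC0).2 hCμ)
  have hρ1 : ρ < 1 := sub_lt_self _ (div_pos hμ hC0)
  refine ⟨√(ρ⁻¹), Real.one_le_sqrt.2 ((one_le_inv₀ hρ).2 hρ1.le), -(Real.log ρ / T) / 2,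
    half_pos (neg_pos.2 (div_neg_of_neg_of_pos (Real.log_neg hρ hρ1) hT)), ?_⟩
  intro x hx t₀ t ht₀ ht
  have hanti := antitoneOn_sq_norm_of_gradient_flow hσ hx
  have hstep : ∀ s ≥ (0:ℝ), x (s + T) ⬝ᵥ x (s + T) ≤ ρ * (x s ⬝ᵥ x s) := by
    intro s hs
    have h := sq_norm_le_decrease_of_gradient_flow hσ hc hNc hbd hT hs (hPE s hs) hx
    have hd : x (s + T) ⬝ᵥ x (s + T) ≤ x s ⬝ᵥ x s :=
      hanti hs (Set.mem_Ici.2 (by positivity)) (by linarith)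
    have hmul : μ₁ * (x s ⬝ᵥ x s) ≤ C * (x s ⬝ᵥ x s - x (s + T) ⬝ᵥ x (s + T)) := by
      rw [hC, add_mul]
      have := mul_nonneg hμ.le (sub_nonneg.2 hd)
      linarith
    have := (div_le_iff₀' hC0).2 hmul
    rw [hρdef, sub_mul, one_mul, div_mul_eq_mul_div]
    linarith
  have hdecay := le_exp_of_contraction hT hρ hρ1 (fun s => dotProduct_self_nonneg_real (x s))
    hanti hstep ht₀ ht
  have hsq : ∀ s, ∑ i, x s i ^ 2 = x s ⬝ᵥ x s := fun s => by simp only [dotProduct, sq]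
  rw [hsq, hsq]
  refine (Real.sqrt_le_sqrt hdecay).trans_eq ?_
  rw [Real.sqrt_mul (by positivity), Real.sqrt_mul (by positivity), ← Real.exp_half]
  ring_nf
end
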